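/- arXiv:1903.07910 — 3 statements merged into one kernel-verified Lean document; each statement's English description precedes it below -/
import Mathlib

section
/- Let (Ω, 𝒜, P) be a probability space and (𝒢_n)_{n∈ℕ} a filtration on it. Let (X_n)_{n∈ℕ} be a sequence of nonnegative integrable random variables, each measurable with respect to σ(⋃_n 𝒢_n), such that X_n is pointwise nondecreasing in n with pointwise limit X, and X is integrable. Then E[X_n | 𝒢_n] converges to X almost surely and in L¹(P) as n → ∞. -/
open MeasureTheory Filter Topology

/-- Increasing case of the lemma on conditional expectations of monotone sequences:
if `X n` are nonnegative, integrable, measurable w.r.t. `⨆ n, 𝒢 n`, pointwise nondecreasing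
with pointwise limit `X` integrable, then `E[X n | 𝒢 n] → X` almost surely and in `L¹`. -/
theorem condexp_tendsto_of_monotone
    {Ω : Type*} {m : MeasurableSpace Ω} {μ : Measure Ω} [IsProbabilityMeasure μ]
    (𝒢 : Filtration ℕ m) (X : ℕ → Ω → ℝ) (Xlim : Ω → ℝ)
    (hmeas : ∀ n, Measurable[⨆ k, 𝒢 k] (X n))
    (hnonneg : ∀ n ω, 0 ≤ X n ω)
    (hint : ∀ n, Integrable (X n) μ)
    (hmono : ∀ n ω, X n ω ≤ X (n + 1) ω)
    (hlim : ∀ ω, Tendsto (fun n => X n ω) atTop (𝓝 (Xlim ω)))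
    (hintlim : Integrable Xlim μ) :
    (∀ᵐ ω ∂μ, Tendsto (fun n => (μ[X n | 𝒢 n]) ω) atTop (𝓝 (Xlim ω))) ∧
      Tendsto (fun n => ∫ ω, |(μ[X n | 𝒢 n]) ω - Xlim ω| ∂μ) atTop (𝓝 0) := by
  have hmono' : ∀ ω, Monotone fun n => X n ω := fun ω => monotone_nat_of_le_succ fun n => hmono n ω
  have hle : ∀ n ω, X n ω ≤ Xlim ω := fun n ω => (hmono' ω).ge_of_tendsto (hlim ω) n
  have hmeaslim : Measurable[⨆ k, 𝒢 k] Xlim :=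
    @measurable_of_tendsto_metrizable _ _ (⨆ k, (𝒢 k : MeasurableSpace Ω)) _ _ _ _ _ _ hmeas (tendsto_pi_nhds.2 hlim)
  refine ⟨?_, ?_⟩
  · have hconv : ∀ k, ∀ᵐ ω ∂μ, Tendsto (fun n => (μ[X k | 𝒢 n]) ω) atTop (𝓝 (X k ω)) :=
      fun k => (hint k).tendsto_ae_condExp (hmeas k).stronglyMeasurable
    have hcondMono : ∀ k n, k ≤ n → ∀ᵐ ω ∂μ, (μ[X k | 𝒢 n]) ω ≤ (μ[X n | 𝒢 n]) ω :=
      fun k n hkn => condExp_mono (hint k) (hint n) (ae_of_all _ fun ω => hmono' ω hkn)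
    have hcondLe : ∀ n, ∀ᵐ ω ∂μ, (μ[X n | 𝒢 n]) ω ≤ (μ[Xlim | 𝒢 n]) ω :=
      fun n => condExp_mono (hint n) hintlim (ae_of_all _ (hle n))
    simp only [← ae_all_iff] at hconv hcondMono hcondLe
    filter_upwards [hconv, hcondMono, hcondLe,
      hintlim.tendsto_ae_condExp hmeaslim.stronglyMeasurable] with ω h₁ h₂ h₃ h₄
    refine tendsto_order.2 ⟨fun a ha => ?_, fun b hb => ?_⟩
    · obtain ⟨k, hk⟩ := ((hlim ω).eventually_const_lt ha).exists
      filter_upwards [(h₁ k).eventually_const_lt hk, eventually_ge_atTop k] with n hn hkn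
      exact hn.trans_le (h₂ k n hkn)
    · filter_upwards [h₄.eventually_lt_const hb] with n hn
      exact (h₃ n).trans_lt hn
  · have hX : Tendsto (fun n => ∫ ω, |X n ω - Xlim ω| ∂μ) atTop (𝓝 0) := by
      have h := (integral_tendsto_of_tendsto_of_monotone hint hintlim (ae_of_all _ hmono')
        (ae_of_all _ hlim)).const_sub (∫ ω, Xlim ω ∂μ)
      rw [sub_self] at h
      refine h.congr fun n => ?_
      rw [← integral_sub hintlim (hint n)]
      refine integral_congr_ae (ae_of_all _ fun ω => ?_)
      simp only [abs_sub_comm (X n ω), abs_of_nonneg (sub_nonneg.2 (hle n ω))]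
    have hlevy : Tendsto (fun n => ∫ ω, |(μ[Xlim | 𝒢 n]) ω - Xlim ω| ∂μ) atTop (𝓝 0) := by
      have h := (ENNReal.tendsto_toReal ENNReal.zero_ne_top).comp
        (hintlim.tendsto_eLpNorm_condExp hmeaslim.stronglyMeasurable)
      refine h.congr fun n => ?_
      have hi : Integrable (μ[Xlim | 𝒢 n] - Xlim) μ := integrable_condExp.sub hintlim
      simp only [Function.comp_apply, eLpNorm_one_eq_lintegral_enorm]
      exact (integral_norm_eq_lintegral_enorm hi.aestronglyMeasurable).symm
    refine squeeze_zero (fun n => integral_nonneg fun ω => abs_nonneg _) (fun n => ?_)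
      (by simpa using hX.add hlevy)
    have hi : Integrable (fun ω => (μ[X n - Xlim | 𝒢 n]) ω) μ := integrable_condExp
    have hj : Integrable (fun ω => (μ[Xlim | 𝒢 n]) ω - Xlim ω) μ :=
      integrable_condExp.sub hintlim
    calc ∫ ω, |(μ[X n | 𝒢 n]) ω - Xlim ω| ∂μ
        ≤ ∫ ω, (|(μ[X n - Xlim | 𝒢 n]) ω| + |(μ[Xlim | 𝒢 n]) ω - Xlim ω|) ∂μ := by
          refine integral_mono_ae (integrable_condExp.sub hintlim).abs (hi.abs.add hj.abs) ?_
          filter_upwards [condExp_sub (hint n) hintlim (𝒢 n)] with ω hω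
          simp only [hω, Pi.sub_apply]
          exact abs_sub_le _ _ _
      _ = ∫ ω, |(μ[X n - Xlim | 𝒢 n]) ω| ∂μ + ∫ ω, |(μ[Xlim | 𝒢 n]) ω - Xlim ω| ∂μ :=
          integral_add hi.abs hj.abs
      _ ≤ ∫ ω, |X n ω - Xlim ω| ∂μ + ∫ ω, |(μ[Xlim | 𝒢 n]) ω - Xlim ω| ∂μ :=
          add_le_add (integral_abs_condExp_le (X n - Xlim)) le_rfl
end

section
/- Let (Ω, 𝒜, P) be a probability space and (𝒢_n)_{n∈ℕ} a filtration on it. Let (X_n)_{n∈ℕ} be a sequence of nonnegative integrable random variables, each measurable with respect to σ(⋃_n 𝒢_n), such that X_n is pointwise nonincreasing in n with pointwise limit X (automatically integrable). Then E[X_n | 𝒢_n] converges to X almost surely and in L¹(P) as n → ∞. -/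
open MeasureTheory Filter Topology

/-- Decreasing case of the lemma on conditional expectations of monotone sequences:
if `X n` are nonnegative, integrable, measurable w.r.t. `⨆ n, 𝒢 n`, pointwise nonincreasing
with pointwise limit `X` (automatically integrable), then `E[X n | 𝒢 n] → X` almost surely
and in `L¹`. -/
theorem condexp_tendsto_of_antitone
    {Ω : Type*} {m : MeasurableSpace Ω} {μ : Measure Ω} [IsProbabilityMeasure μ]
    (𝒢 : Filtration ℕ m) (X : ℕ → Ω → ℝ) (Xlim : Ω → ℝ)
    (hmeas : ∀ n, Measurable[⨆ k, 𝒢 k] (X n))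
    (hnonneg : ∀ n ω, 0 ≤ X n ω)
    (hint : ∀ n, Integrable (X n) μ)
    (hmono : ∀ n ω, X (n + 1) ω ≤ X n ω)
    (hlim : ∀ ω, Tendsto (fun n => X n ω) atTop (𝓝 (Xlim ω))) :
    (∀ᵐ ω ∂μ, Tendsto (fun n => (μ[X n | 𝒢 n]) ω) atTop (𝓝 (Xlim ω))) ∧
      Tendsto (fun n => ∫ ω, |(μ[X n | 𝒢 n]) ω - Xlim ω| ∂μ) atTop (𝓝 0) := by
  have hanti : ∀ ω, Antitone fun n => X n ω := fun ω => antitone_nat_of_succ_le (hmono · ω)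
  have hle : ∀ n ω, Xlim ω ≤ X n ω := fun n ω => (hanti ω).le_of_tendsto (hlim ω) n
  have hlim_nonneg : ∀ ω, 0 ≤ Xlim ω := fun ω => ge_of_tendsto' (hlim ω) (hnonneg · ω)
  have hlim_meas : Measurable[⨆ k, 𝒢 k] Xlim :=
    @measurable_of_tendsto_metrizable Ω ℝ (⨆ k, 𝒢 k) _ _ _ _ _ _ hmeas (tendsto_pi_nhds.2 hlim)
  have hlim_int : Integrable Xlim μ := by
    refine (hint 0).mono' (hlim_meas.mono (iSup_le 𝒢.le) le_rfl).aestronglyMeasurable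
      (.of_forall fun ω => ?_)
    rw [Real.norm_of_nonneg (hlim_nonneg ω)]
    exact hle 0 ω
  constructor
  · have hupper : ∀ k, ∀ᵐ ω ∂μ, Tendsto (fun n => (μ[X k | 𝒢 n]) ω) atTop (𝓝 (X k ω)) :=
      fun k => (hint k).tendsto_ae_condExp (hmeas k).stronglyMeasurable
    have hmono_upper : ∀ k n, k ≤ n → ∀ᵐ ω ∂μ, (μ[X n | 𝒢 n]) ω ≤ (μ[X k | 𝒢 n]) ω :=
      fun k n hkn => condExp_mono (hint n) (hint k) (.of_forall fun ω => hanti ω hkn)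
    have hmono_lower : ∀ n, ∀ᵐ ω ∂μ, (μ[Xlim | 𝒢 n]) ω ≤ (μ[X n | 𝒢 n]) ω :=
      fun n => condExp_mono hlim_int (hint n) (.of_forall (hle n))
    simp only [← ae_all_iff] at hupper hmono_upper hmono_lower
    filter_upwards [hupper, hmono_upper, hmono_lower,
      hlim_int.tendsto_ae_condExp hlim_meas.stronglyMeasurable] with ω hup hmu hml hlow
    refine tendsto_order.2 ⟨fun a ha => ?_, fun b hb => ?_⟩
    · filter_upwards [hlow.eventually_const_lt ha] with n hn using hn.trans_le (hml n)
    · obtain ⟨k, hk⟩ := ((hlim ω).eventually_lt_const hb).exists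
      filter_upwards [(hup k).eventually_lt_const hk, eventually_ge_atTop k] with n hn hkn
        using (hmu k n hkn).trans_lt hn
  · have hX : Tendsto (fun n => ∫ ω, |(X n - Xlim) ω| ∂μ) atTop (𝓝 0) := by
      rw [← integral_zero Ω ℝ (μ := μ)]
      refine tendsto_integral_of_dominated_convergence (X 0)
        (fun n => ((hint n).sub hlim_int).abs.aestronglyMeasurable) (hint 0)
        (fun n => .of_forall fun ω => ?_) (.of_forall fun ω => ?_)
      · rw [Real.norm_eq_abs, abs_abs, Pi.sub_apply, abs_of_nonneg (sub_nonneg.2 (hle n ω))]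
        linarith [hlim_nonneg ω, hanti ω n.zero_le]
      · simpa using ((hlim ω).sub_const (Xlim ω)).abs
    have hlevy : Tendsto (fun n => ∫ ω, |(μ[Xlim | 𝒢 n] - Xlim) ω| ∂μ) atTop (𝓝 0) := by
      have h := (ENNReal.tendsto_toReal ENNReal.zero_ne_top).comp
        (hlim_int.tendsto_eLpNorm_condExp (ℱ := 𝒢) hlim_meas.stronglyMeasurable)
      refine h.congr fun n => ?_
      simp_rw [Function.comp_apply, eLpNorm_one_eq_lintegral_enorm, ← Real.norm_eq_abs]
      exact (integral_norm_eq_lintegral_enorm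
        (integrable_condExp.sub hlim_int).aestronglyMeasurable).symm
    refine squeeze_zero (fun n => integral_nonneg fun ω => abs_nonneg _) (fun n => ?_)
      (by simpa using hX.add hlevy)
    calc ∫ ω, |(μ[X n | 𝒢 n]) ω - Xlim ω| ∂μ
        ≤ ∫ ω, (|(μ[X n - Xlim | 𝒢 n]) ω| + |(μ[Xlim | 𝒢 n] - Xlim) ω|) ∂μ := by
          refine integral_mono_ae (integrable_condExp.sub hlim_int).abs
            (integrable_condExp.abs.add (integrable_condExp.sub hlim_int).abs) ?_
          filter_upwards [condExp_sub (hint n) hlim_int (𝒢 n)] with ω hω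
          rw [hω]
          exact abs_sub_le _ _ _
      _ = ∫ ω, |(μ[X n - Xlim | 𝒢 n]) ω| ∂μ + ∫ ω, |(μ[Xlim | 𝒢 n] - Xlim) ω| ∂μ :=
          integral_add integrable_condExp.abs (integrable_condExp.sub hlim_int).abs
      _ ≤ ∫ ω, |(X n - Xlim) ω| ∂μ + ∫ ω, |(μ[Xlim | 𝒢 n] - Xlim) ω| ∂μ :=
          add_le_add_left (integral_abs_condExp_le _) _
end

section
/- Let V be a countable set and (Ω, 𝒜) a measurable space. For every nonempty finite subset K ⊆ V let μ_K be a finite measure on (Ω, 𝒜) and W_K ∈ 𝒜 a measurable set, such that: (i) K ⊆ K' implies W_K ⊆ W_{K'} and 1_{W_K}·μ_{K'} = μ_K (in particular each μ_K is supported on W_K); and (ii) ⋃_K W_K = Ω, the union over all nonempty finite K ⊆ V. Then there exists a unique measure ν on (Ω, 𝒜) such that 1_{W_K}·ν = μ_K for every nonempty finite K ⊆ V; this measure ν is σ-finite and is given by ν(A) = sup_K μ_K(A) for all A ∈ 𝒜, the supremum over all nonempty finite K ⊆ V. -/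
open MeasureTheory

/-- The setwise supremum of a directed family of measures is a measure. -/
theorem exists_measure_eq_iSup_of_directed {ι Ω : Type*} [MeasurableSpace Ω]
    (m : ι → Measure Ω) (hm : Directed (· ≤ ·) m) :
    ∃ ν : Measure Ω, ∀ A : Set Ω, MeasurableSet A → ν A = ⨆ i, m i A := by
  refine ⟨Measure.ofMeasurable (fun A _ => ⨆ i, m i A) (by simp) fun f hf hd => ?_,
    fun A hA => Measure.ofMeasurable_apply A hA⟩
  simp_rw [measure_iUnion hd hf, ENNReal.tsum_eq_iSup_sum]
  rw [iSup_comm]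
  refine iSup_congr fun s => (ENNReal.finsetSum_iSup fun i j => ?_).symm
  obtain ⟨k, hik, hjk⟩ := hm i j
  exact ⟨k, fun a => ⟨hik _, hjk _⟩⟩

/-- Measure-theoretic core of the existence, uniqueness and σ-finiteness of the interlacement
intensity measure: given finite measures `μ K` and measurable sets `W K` indexed by nonempty
finite subsets `K` of a countable set `V`, consistent under inclusion and covering `Ω`,
there is a unique measure `ν` with `1_{W K}·ν = μ K` for all such `K`; it is σ-finite and
`ν A = ⨆ K, μ K A` for all measurable `A`. -/
theorem exists_unique_intensity_measure
    {V : Type*} [Countable V] {Ω : Type*} [MeasurableSpace Ω]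
    (μ : Finset V → Measure Ω) (W : Finset V → Set Ω)
    (hfin : ∀ K : Finset V, K.Nonempty → IsFiniteMeasure (μ K))
    (hWmeas : ∀ K : Finset V, K.Nonempty → MeasurableSet (W K))
    (hWmono : ∀ K K' : Finset V, K.Nonempty → K'.Nonempty → K ⊆ K' → W K ⊆ W K')
    (hcons : ∀ K K' : Finset V, K.Nonempty → K'.Nonempty → K ⊆ K' →
      (μ K').restrict (W K) = μ K)
    (hcover : ⋃ K ∈ {K : Finset V | K.Nonempty}, W K = Set.univ) :
    (∃! ν : Measure Ω, ∀ K : Finset V, K.Nonempty → ν.restrict (W K) = μ K) ∧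
    ∀ ν : Measure Ω, (∀ K : Finset V, K.Nonempty → ν.restrict (W K) = μ K) →
      SigmaFinite ν ∧
      ∀ A : Set Ω, MeasurableSet A →
        ν A = ⨆ (K : Finset V) (_ : K.Nonempty), μ K A := by
  have hcover' : ⋃ K : {K : Finset V // K.Nonempty}, W K = Set.univ := by
    rw [← hcover, Set.biUnion_eq_iUnion]
    rfl
  have hmono : ∀ K K' : Finset V, K.Nonempty → K'.Nonempty → K ⊆ K' → μ K ≤ μ K' := by
    intro K K' hK hK' h
    rw [← hcons K K' hK hK' h]
    exact Measure.restrict_le_self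
  obtain ⟨ν₀, hν₀⟩ := exists_measure_eq_iSup_of_directed
    (fun K : {K : Finset V // K.Nonempty} => μ K) (by
      classical
      intro K K'
      have hL : (K ∪ K' : Finset V).Nonempty := K.2.mono Finset.subset_union_left
      exact ⟨⟨K ∪ K', hL⟩, hmono K _ K.2 hL Finset.subset_union_left,
        hmono K' _ K'.2 hL Finset.subset_union_right⟩)
  have hrestrict : ∀ K : Finset V, K.Nonempty → ν₀.restrict (W K) = μ K := by
    classical
    intro K hK
    ext A hA
    rw [Measure.restrict_apply hA, hν₀ _ (hA.inter (hWmeas K hK))]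
    apply le_antisymm
    · refine iSup_le fun K' => ?_
      have hL : (K ∪ K').Nonempty := hK.mono Finset.subset_union_left
      rw [← hcons K (K ∪ K') hK hL Finset.subset_union_left, Measure.restrict_apply hA]
      exact hmono K' _ K'.2 hL Finset.subset_union_right _
    · refine le_iSup_of_le ⟨K, hK⟩ ?_
      rw [← Measure.restrict_apply hA, hcons K K hK hK subset_rfl]
  have hunique : ∀ ν : Measure Ω,
      (∀ K : Finset V, K.Nonempty → ν.restrict (W K) = μ K) → ν = ν₀ := fun ν hν =>
    Measure.ext_of_iUnion_eq_univ hcover' fun K => (hν K K.2).trans (hrestrict K K.2).symm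
  refine ⟨⟨ν₀, hrestrict, hunique⟩, fun ν hν => ⟨?_, fun A hA => ?_⟩⟩
  · refine Measure.sigmaFinite_of_countable
      (S := Set.range fun K : {K : Finset V // K.Nonempty} => W K)
      (Set.countable_range _) ?_ (by rw [Set.sUnion_range, hcover'])
    rintro _ ⟨K, rfl⟩
    have := hfin K K.2
    rw [← Measure.restrict_apply_univ, hν K K.2]
    exact measure_lt_top _ _
  · rw [hunique ν hν, hν₀ A hA, iSup_subtype]
end
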